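/- arXiv:1207.3696 — 4 statements merged into one kernel-verified Lean document; each statement's English description precedes it below -/
import Mathlib

section
/- Let I ⊂ ℝ be an open bounded interval, let 1 ≤ p ≤ ∞ and 1 < r ≤ ∞, and let B₀, B, B₁ be Banach spaces together with an injective compact linear operator j₀ : B₀ → B and an injective continuous linear operator j : B → B₁. Let (vₙ) be a sequence of strongly measurable functions vₙ : I → B₀ such that supₙ ‖vₙ‖_{L^p(I,B₀)} < ∞, and suppose that for each n there exists wₙ ∈ L^r(I,B₁) with supₙ ‖wₙ‖_{L^r(I,B₁)} < ∞ and j(j₀(vₙ(t))) − j(j₀(vₙ(s))) = ∫ₛᵗ wₙ(τ) dτ for almost every s < t in I. Then the sequence (j₀ ∘ vₙ) has a subsequence that converges in L^p(I,B). (Aubin–Lions compactness theorem.) -/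
open MeasureTheory Filter
open scoped ENNReal

/-- Ehrling's inequality for a compact operator followed by an injective continuous one. -/
theorem exists_norm_le_mul_norm_add {B₀ B B₁ : Type*}
    [NormedAddCommGroup B₀] [NormedSpace ℝ B₀] [NormedAddCommGroup B] [NormedSpace ℝ B]
    [NormedAddCommGroup B₁] [NormedSpace ℝ B₁]
    {j₀ : B₀ →L[ℝ] B} (hj₀ : IsCompactOperator (⇑j₀))
    {j : B →L[ℝ] B₁} (hj : Function.Injective (⇑j)) {ε : ℝ} (hε : 0 < ε) :
    ∃ K : ℝ, 0 ≤ K ∧ ∀ x, ‖j₀ x‖ ≤ ε * ‖x‖ + K * ‖j (j₀ x)‖ := by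
  obtain ⟨S, hS, hjS⟩ := hj₀.image_closedBall_subset_compact (f := j₀.toLinearMap) 1
  have hT : IsCompact (S ∩ {y | ε ≤ ‖y‖}) :=
    hS.inter_right (isClosed_le continuous_const continuous_norm)
  obtain ⟨c, hc, hcT⟩ : ∃ c : ℝ, 0 < c ∧ ∀ y ∈ S ∩ {y | ε ≤ ‖y‖}, c ≤ ‖j y‖ := by
    refine hT.exists_forall_le' (f := fun y => ‖j y‖) (a := 0) (by fun_prop) ?_
    rintro y ⟨-, hy⟩
    refine norm_pos_iff.2 fun h => ?_
    have : y = 0 := hj (by simpa using h)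
    simp only [Set.mem_ofPred_eq, this, norm_zero] at hy
    linarith
  refine ⟨‖j₀‖ / c, by positivity, fun x => ?_⟩
  rcases eq_or_ne x 0 with rfl | hx
  · simp
  have hx' : 0 < ‖x‖ := norm_pos_iff.2 hx
  rcases le_or_gt ‖j₀ x‖ (ε * ‖x‖) with h | h
  · have : 0 ≤ ‖j₀‖ / c * ‖j (j₀ x)‖ := by positivity
    linarith
  · have hmem : j₀ (‖x‖⁻¹ • x) ∈ S ∩ {y | ε ≤ ‖y‖} := by
      refine ⟨hjS ⟨_, ?_, rfl⟩, ?_⟩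
      · simp [norm_smul, hx'.ne']
      · rw [Set.mem_ofPred_eq, map_smul, norm_smul, norm_inv, norm_norm, ← div_eq_inv_mul,
          le_div_iff₀ hx']
        exact h.le
    have h1 := hcT _ hmem
    rw [map_smul, map_smul, norm_smul, norm_inv, norm_norm, ← div_eq_inv_mul,
      le_div_iff₀ hx'] at h1
    have h2 : ‖j₀ x‖ ≤ ‖j₀‖ / c * ‖j (j₀ x)‖ := by
      calc ‖j₀ x‖ ≤ ‖j₀‖ * ‖x‖ := j₀.le_opNorm x
        _ = ‖j₀‖ / c * (c * ‖x‖) := by field_simp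
        _ ≤ _ := by gcongr
    have : 0 ≤ ε * ‖x‖ := by positivity
    linarith

/-- A one-sided almost-everywhere oscillation bound holds for almost every pair in either order. -/
theorem ae_ae_norm_sub_le {E : Type*} [NormedAddCommGroup E] {μ : Measure ℝ} [SFinite μ]
    {g : ℝ → E} (hg : AEStronglyMeasurable g μ) {ε : ℝ} (hε : 0 ≤ ε)
    (h : ∀ᵐ s ∂μ, ∀ᵐ t ∂μ, s < t → ‖g t - g s‖ ≤ ε) :
    ∀ᵐ t ∂μ, ∀ᵐ s ∂μ, ‖g t - g s‖ ≤ ε := by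
  have hmk : ∀ᵐ s ∂μ, ∀ᵐ t ∂μ, s < t → ‖hg.mk g t - hg.mk g s‖ ≤ ε := by
    filter_upwards [h, hg.ae_eq_mk] with s hs hs'
    filter_upwards [hs, hg.ae_eq_mk] with t ht ht'
    rwa [← hs', ← ht']
  have hmeas : MeasurableSet {x : ℝ × ℝ | x.1 < x.2 → ‖hg.mk g x.2 - hg.mk g x.1‖ ≤ ε} := by
    have h1 : MeasurableSet {x : ℝ × ℝ | x.1 < x.2} :=
      measurableSet_lt measurable_fst measurable_snd
    have h2 : MeasurableSet {x : ℝ × ℝ | ‖hg.mk g x.2 - hg.mk g x.1‖ ≤ ε} :=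
      ((hg.stronglyMeasurable_mk.comp_measurable measurable_snd).sub
        (hg.stronglyMeasurable_mk.comp_measurable measurable_fst)).norm.measurable measurableSet_Iic
    exact h1.imp h2
  filter_upwards [h, (Measure.ae_ae_comm hmeas).1 hmk, hg.ae_eq_mk] with t ht ht' htm
  filter_upwards [ht, ht', hg.ae_eq_mk] with s hs hs' hsm
  rcases lt_trichotomy s t with hst | rfl | hst
  · rw [hsm, htm]
    exact hs' hst
  · simpa using hε
  · rw [norm_sub_rev]
    exact hs hst

/-- A function whose oscillation is at most `ε` stays within `ε` of its average. -/
theorem ae_norm_sub_average_le {E : Type*} [NormedAddCommGroup E] [NormedSpace ℝ E]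
    [CompleteSpace E] {μ : Measure ℝ} [IsFiniteMeasure μ]
    {g : ℝ → E} (hg : Integrable g μ) {ε : ℝ} (hε : 0 ≤ ε)
    (h : ∀ᵐ s ∂μ, ∀ᵐ t ∂μ, s < t → ‖g t - g s‖ ≤ ε) :
    ∀ᵐ t ∂μ, ‖g t - ⨍ s, g s ∂μ‖ ≤ ε := by
  rcases eq_or_ne μ 0 with rfl | hμ
  · simp
  have : NeZero μ := ⟨hμ⟩
  filter_upwards [ae_ae_norm_sub_le hg.aestronglyMeasurable hε h] with t ht
  have := (convex_closedBall (g t) ε).average_mem Metric.isClosed_closedBall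
    (ht.mono fun s hs => by rwa [mem_closedBall_iff_norm']) hg
  rwa [mem_closedBall_iff_norm'] at this

/-- Hölder bound for the integral over a subinterval. -/
theorem enorm_intervalIntegral_le_eLpNorm_mul_rpow {E : Type*} [NormedAddCommGroup E]
    [NormedSpace ℝ E] {a b : ℝ} {r : ℝ≥0∞} (hr : 1 ≤ r) {w : ℝ → E}
    (hw : AEStronglyMeasurable w (volume.restrict (Set.Ioo a b))) {s t : ℝ}
    (has : a < s) (hst : s ≤ t) (htb : t < b) :
    ‖∫ τ in s..t, w τ‖ₑ ≤
      eLpNorm w r (volume.restrict (Set.Ioo a b)) *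
        ENNReal.ofReal (t - s) ^ (1 - 1 / r.toReal) := by
  have hsub : Set.Ioc s t ⊆ Set.Ioo a b := fun x hx => ⟨has.trans hx.1, hx.2.trans_lt htb⟩
  have hle := Measure.restrict_mono_set volume hsub
  rw [intervalIntegral.integral_of_le hst]
  calc ‖∫ τ in Set.Ioc s t, w τ‖ₑ ≤ ∫⁻ τ in Set.Ioc s t, ‖w τ‖ₑ :=
        enorm_integral_le_lintegral_enorm _
    _ = eLpNorm w 1 (volume.restrict (Set.Ioc s t)) := eLpNorm_one_eq_lintegral_enorm.symm
    _ ≤ eLpNorm w r (volume.restrict (Set.Ioc s t)) *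
        ENNReal.ofReal (t - s) ^ (1 - 1 / r.toReal) := by
        simpa using eLpNorm_le_eLpNorm_mul_rpow_measure_univ hr (hw.mono_measure hle)
    _ ≤ _ := by
        gcongr

/-- A family that is bounded in `L¹` and whose images under a compact operator are almost everywhere
uniformly equicontinuous has images that are totally bounded for the essential supremum norm. -/
theorem exists_finite_ae_norm_sub_le {ι E F : Type*} [NormedAddCommGroup E] [NormedSpace ℝ E]
    [CompleteSpace E] [NormedAddCommGroup F] [NormedSpace ℝ F] [CompleteSpace F]
    {μ : Measure ℝ} [IsFiniteMeasure μ] {S : Set ℝ} (hS : IsCompact S) (hμS : ∀ᵐ t ∂μ, t ∈ S)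
    {T : E →L[ℝ] F} (hT : IsCompactOperator (⇑T)) {v : ι → ℝ → E}
    (hv : ∀ i, Integrable (v i) μ) {M : ℝ} (hM : ∀ i, ∫ t, ‖v i t‖ ∂μ ≤ M)
    (hmod : ∀ ε > 0, ∃ δ > 0, ∀ i, ∀ᵐ s ∂μ, ∀ᵐ t ∂μ, s < t → t - s < δ →
      ‖T (v i t) - T (v i s)‖ ≤ ε)
    {ε : ℝ} (hε : 0 < ε) :
    ∃ s : Set ι, s.Finite ∧ ∀ i, ∃ k ∈ s, ∀ᵐ t ∂μ, ‖T (v i t) - T (v k t)‖ ≤ ε := by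
  obtain ⟨δ, hδ, hosc⟩ := hmod (ε / 3) (by positivity)
  obtain ⟨c, -, hc, hSc⟩ := hS.finite_cover_balls (half_pos hδ)
  have := hc.fintype
  let ν : c → Measure ℝ := fun x => μ.restrict (Metric.ball x (δ / 2))
  let A : ι → c → F := fun i x => T (⨍ s, v i s ∂ν x)
  have hclose : ∀ i, ∀ x : c, ∀ᵐ t ∂ν x, ‖T (v i t) - A i x‖ ≤ ε / 3 := by
    intro i x
    have hint : Integrable (v i) (ν x) := (hv i).restrict
    have havg : A i x = ⨍ s, T (v i s) ∂ν x := by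
      simp only [A, average_eq, map_smul, T.integral_comp_comm hint]
    rw [havg]
    refine ae_norm_sub_average_le (T.integrable_comp hint) (by positivity) ?_
    filter_upwards [ae_restrict_of_ae (hosc i), ae_restrict_mem Metric.isOpen_ball.measurableSet]
      with s hs hsx
    filter_upwards [ae_restrict_of_ae hs, ae_restrict_mem Metric.isOpen_ball.measurableSet]
      with t ht htx hst
    refine ht hst ?_
    rw [Metric.mem_ball, Real.dist_eq, abs_lt] at hsx htx
    linarith [hsx.1, htx.2]
  have hA : TotallyBounded (Set.range A) := by
    have hK : ∀ x : c, ∃ K : Set F, IsCompact K ∧ ∀ i, A i x ∈ K := by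
      intro x
      obtain ⟨K, hK, hTK⟩ := hT.image_closedBall_subset_compact (f := T.toLinearMap)
        (((ν x).real Set.univ)⁻¹ * M)
      refine ⟨K, hK, fun i => hTK ⟨_, ?_, rfl⟩⟩
      rw [mem_closedBall_zero_iff, average_eq, norm_smul, norm_inv, Real.norm_eq_abs,
        abs_of_nonneg measureReal_nonneg]
      gcongr
      calc ‖∫ s, v i s ∂ν x‖ ≤ ∫ s, ‖v i s‖ ∂ν x := norm_integral_le_integral_norm _
        _ ≤ ∫ s, ‖v i s‖ ∂μ := setIntegral_le_integral (hv i).norm (by filter_upwards; simp)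
        _ ≤ M := hM i
    choose K hK hAK using hK
    refine (isCompact_univ_pi hK).totallyBounded.subset ?_
    rintro _ ⟨i, rfl⟩ x -
    exact hAK x i
  obtain ⟨y, hyA, hy, hcov⟩ := Metric.finite_approx_of_totallyBounded hA (ε / 3) (by positivity)
  obtain ⟨s, rfl, hsinj⟩ := Set.exists_image_eq_injOn_of_subset_range hyA
  have hs : s.Finite := hy.of_finite_image hsinj
  refine ⟨s, hs, fun i => ?_⟩
  obtain ⟨k, hk, hik⟩ : ∃ k ∈ s, dist (A i) (A k) < ε / 3 := by
    simpa using hcov (Set.mem_range_self i)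
  refine ⟨k, hk, ?_⟩
  have hcell : ∀ x : c, ∀ᵐ t ∂ν x, ‖T (v i t) - T (v k t)‖ ≤ ε := by
    intro x
    filter_upwards [hclose i x, hclose k x] with t h1 h2
    have h3 : ‖A i x - A k x‖ < ε / 3 := by
      rw [← dist_eq_norm]
      exact (dist_le_pi_dist (A i) (A k) x).trans_lt hik
    rw [norm_sub_rev] at h2
    calc ‖T (v i t) - T (v k t)‖
        = ‖(T (v i t) - A i x) + (A i x - A k x) + (A k x - T (v k t))‖ := by congr 1; abel
      _ ≤ ‖T (v i t) - A i x‖ + ‖A i x - A k x‖ + ‖A k x - T (v k t)‖ := norm_add₃_le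
      _ ≤ ε := by linarith
  have hall := eventually_all.2 fun x : c =>
    (ae_restrict_iff' Metric.isOpen_ball.measurableSet).1 (hcell x)
  filter_upwards [hall, hμS] with t ht htS
  obtain ⟨x, hx, htx⟩ := Set.mem_iUnion₂.1 (hSc htS)
  exact ht ⟨x, hx⟩ htx

/-- `L^p` form of a pointwise affine bound. -/
theorem eLpNorm_le_of_ae_norm_le_mul_add {α E F : Type*} [MeasurableSpace α] {μ : Measure α}
    [NormedAddCommGroup E] [NormedAddCommGroup F] {p : ℝ≥0∞} (hp : 1 ≤ p)
    {f : α → E} {g : α → F} (hg : AEStronglyMeasurable g μ) {c d : ℝ} (hc : 0 ≤ c) (hd : 0 ≤ d)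
    (h : ∀ᵐ t ∂μ, ‖f t‖ ≤ c * ‖g t‖ + d) :
    eLpNorm f p μ ≤
      ENNReal.ofReal c * eLpNorm g p μ + μ Set.univ ^ p.toReal⁻¹ * ENNReal.ofReal d := by
  calc eLpNorm f p μ ≤ eLpNorm ((fun t => c * ‖g t‖) + fun _ => d) p μ := eLpNorm_mono_ae_real h
    _ ≤ eLpNorm (fun t => c * ‖g t‖) p μ + eLpNorm (fun _ => d) p μ :=
        eLpNorm_add_le (hg.norm.const_mul c) aestronglyMeasurable_const hp
    _ ≤ _ := by
        gcongr
        · refine eLpNorm_le_mul_eLpNorm_of_ae_le_mul (ae_of_all _ fun t => ?_) p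
          simp [abs_of_nonneg hc]
        · exact eLpNorm_le_of_ae_bound (ae_of_all _ fun t => by simp [abs_of_nonneg hd])

/-- The Hölder modulus `h ↦ C * h ^ α` is arbitrarily small for small `h`. -/
theorem exists_forall_mul_ofReal_rpow_le {C : ℝ≥0∞} (hC : C ≠ ⊤) {α : ℝ} (hα : 0 < α)
    {ε : ℝ} (hε : 0 < ε) :
    ∃ δ > 0, ∀ h : ℝ, 0 < h → h < δ → C * ENNReal.ofReal h ^ α ≤ ENNReal.ofReal ε := by
  have hlim : Tendsto (fun h : ℝ => C * ENNReal.ofReal h ^ α) (nhds 0) (nhds 0) := by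
    have h1 : Tendsto (fun h : ℝ => ENNReal.ofReal h ^ α) (nhds 0) (nhds 0) := by
      have := (ENNReal.continuous_rpow_const (y := α)).comp ENNReal.continuous_ofReal
      simpa [Function.comp_def, ENNReal.zero_rpow_of_pos hα] using this.tendsto 0
    simpa using ENNReal.Tendsto.const_mul h1 (Or.inr hC)
  obtain ⟨δ, hδ, h⟩ := Metric.eventually_nhds_iff.1
    (hlim.eventually (ge_mem_nhds (ENNReal.ofReal_pos.2 hε)))
  exact ⟨δ, hδ, fun x hx hxδ => h (by simpa [abs_of_pos hx] using hxδ)⟩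

/-- **Aubin–Lions compactness theorem.** Let `I = (a,b)` be an open bounded interval,
`1 ≤ p ≤ ∞`, `1 < r ≤ ∞`, and let `B₀, B, B₁` be Banach spaces together with an injective
compact linear operator `j₀ : B₀ → B` and an injective continuous linear operator
`j : B → B₁`. If `(vₙ)` is bounded in `L^p(I,B₀)` and there are `wₙ`, bounded in
`L^r(I,B₁)`, with `j(j₀(vₙ(t))) − j(j₀(vₙ(s))) = ∫ₛᵗ wₙ(τ) dτ` for a.e. `s < t` in `I`,
then `(j₀ ∘ vₙ)` has a subsequence converging in `L^p(I,B)`. -/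
theorem aubin_lions
    {B₀ B B₁ : Type*}
    [NormedAddCommGroup B₀] [NormedSpace ℝ B₀] [CompleteSpace B₀]
    [NormedAddCommGroup B] [NormedSpace ℝ B] [CompleteSpace B]
    [NormedAddCommGroup B₁] [NormedSpace ℝ B₁] [CompleteSpace B₁]
    (a b : ℝ) (hab : a < b)
    (p r : ℝ≥0∞) (hp : 1 ≤ p) (hr : 1 < r)
    (j₀ : B₀ →L[ℝ] B) (hj₀c : IsCompactOperator (⇑j₀)) (hj₀i : Function.Injective (⇑j₀))
    (j : B →L[ℝ] B₁) (hji : Function.Injective (⇑j))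
    (v : ℕ → ℝ → B₀) (w : ℕ → ℝ → B₁)
    (hvm : ∀ n, AEStronglyMeasurable (v n) (volume.restrict (Set.Ioo a b)))
    (hwm : ∀ n, AEStronglyMeasurable (w n) (volume.restrict (Set.Ioo a b)))
    (C : ℝ≥0∞) (hC : C ≠ ⊤)
    (hv : ∀ n, eLpNorm (v n) p (volume.restrict (Set.Ioo a b)) ≤ C)
    (hw : ∀ n, eLpNorm (w n) r (volume.restrict (Set.Ioo a b)) ≤ C)
    (hder : ∀ n, ∀ᵐ s ∂(volume.restrict (Set.Ioo a b)),
      ∀ᵐ t ∂(volume.restrict (Set.Ioo a b)), s < t →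
        j (j₀ (v n t)) - j (j₀ (v n s)) = ∫ τ in s..t, w n τ) :
    ∃ φ : ℕ → ℕ, StrictMono φ ∧ ∃ u : ℝ → B,
      Tendsto (fun k => eLpNorm (fun t => j₀ (v (φ k) t) - u t) p
        (volume.restrict (Set.Ioo a b))) atTop (nhds 0) := by
  have : Fact (1 ≤ p) := ⟨hp⟩
  set μ : Measure ℝ := volume.restrict (Set.Ioo a b)
  have hvL : ∀ n, MemLp (v n) p μ := fun n => ⟨hvm n, (hv n).trans_lt hC.lt_top⟩
  have hvi : ∀ n, Integrable (v n) μ := fun n => (hvL n).integrable hp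
  have hα : 0 < 1 - 1 / r.toReal := by
    rcases eq_or_ne r ⊤ with rfl | hr'
    · simp
    · have : 1 < r.toReal := by simpa using (ENNReal.toReal_lt_toReal (by simp) hr').2 hr
      rw [sub_pos, div_lt_one (by linarith)]
      exact this
  have hmod : ∀ ε > 0, ∃ δ > 0, ∀ n, ∀ᵐ s ∂μ, ∀ᵐ t ∂μ, s < t → t - s < δ →
      ‖(j.comp j₀) (v n t) - (j.comp j₀) (v n s)‖ ≤ ε := by
    intro ε hε
    obtain ⟨δ, hδ, hsmall⟩ := exists_forall_mul_ofReal_rpow_le hC hα hε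
    refine ⟨δ, hδ, fun n => ?_⟩
    filter_upwards [hder n, ae_restrict_mem measurableSet_Ioo] with s hs hsI
    filter_upwards [hs, ae_restrict_mem measurableSet_Ioo] with t ht htI hst htδ
    rw [j.comp_apply, j.comp_apply, ht hst, ← ENNReal.ofReal_le_ofReal_iff hε.le, ofReal_norm]
    calc _ ≤ _ := enorm_intervalIntegral_le_eLpNorm_mul_rpow hr.le (hwm n) hsI.1 hst.le htI.2
      _ ≤ C * ENNReal.ofReal (t - s) ^ (1 - 1 / r.toReal) := by gcongr; exact hw n
      _ ≤ _ := hsmall _ (sub_pos.2 hst) htδ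
  set D : ℝ≥0∞ := μ Set.univ ^ (1 / (1 : ℝ≥0∞).toReal - 1 / p.toReal)
  have hDtop : D ≠ ⊤ := by
    refine ENNReal.rpow_ne_top_of_nonneg ?_ (measure_ne_top _ _)
    rcases eq_or_ne p ⊤ with rfl | hp'
    · simp
    · have : 1 ≤ p.toReal := by simpa using (ENNReal.toReal_le_toReal (by simp) hp').2 hp
      simpa using inv_le_one_of_one_le₀ this
  have hM : ∀ n, ∫ t, ‖v n t‖ ∂μ ≤ (C * D).toReal := by
    intro n
    rw [integral_norm_eq_lintegral_enorm (hvm n), ← eLpNorm_one_eq_lintegral_enorm]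
    refine ENNReal.toReal_mono (ENNReal.mul_ne_top hC hDtop) ?_
    refine (eLpNorm_le_eLpNorm_mul_rpow_measure_univ hp (hvm n)).trans ?_
    gcongr
    exact hv n
  have huL : ∀ n, MemLp (fun t => j₀ (v n t)) p μ := fun n => j₀.comp_memLp' (hvL n)
  let U : ℕ → Lp B p μ := fun n => (huL n).toLp _
  have hU : TotallyBounded (Set.range U) := by
    rw [Metric.totallyBounded_iff]
    intro ε hε
    have hmtop : μ Set.univ ^ p.toReal⁻¹ ≠ ⊤ :=
      ENNReal.rpow_ne_top_of_nonneg (by positivity) (measure_ne_top _ _)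
    set m : ℝ := (μ Set.univ ^ p.toReal⁻¹).toReal
    set δ : ℝ := ε / (4 * (C.toReal + 1))
    have hδ : 0 < δ := by positivity
    obtain ⟨K, hK, hKle⟩ := exists_norm_le_mul_norm_add hj₀c hji hδ
    set η : ℝ := ε / (4 * ((K + 1) * (m + 1)))
    have hη : 0 < η := by positivity
    obtain ⟨s, hs, hsη⟩ := exists_finite_ae_norm_sub_le (isCompact_Icc (a := a) (b := b))
      ((ae_restrict_mem measurableSet_Ioo).mono fun t ht => Set.Ioo_subset_Icc_self ht)
      (T := j.comp j₀) (hj₀c.clm_comp j) hvi hM hmod hη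
    refine ⟨U '' s, hs.image U, ?_⟩
    rintro _ ⟨n, rfl⟩
    obtain ⟨k, hk, hnk⟩ := hsη n
    refine Set.mem_iUnion₂.2 ⟨U k, Set.mem_image_of_mem U hk, ?_⟩
    rw [Metric.mem_ball, ← edist_lt_ofReal, Lp.edist_toLp_toLp]
    have hbound : ∀ᵐ t ∂μ, ‖((fun t => j₀ (v n t)) - fun t => j₀ (v k t)) t‖ ≤
        δ * ‖(v n - v k) t‖ + K * η := by
      filter_upwards [hnk] with t ht
      have h := hKle (v n t - v k t)
      rw [map_sub, map_sub] at h
      refine h.trans ?_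
      gcongr
      · exact le_rfl
      · exact ht
    have hsub : eLpNorm (v n - v k) p μ ≤ C + C :=
      (eLpNorm_sub_le (hvm n) (hvm k) hp).trans (add_le_add (hv n) (hv k))
    have hδC : δ * (C.toReal + C.toReal) < ε / 2 := by
      have : δ * (4 * (C.toReal + 1)) = ε := div_mul_cancel₀ _ (by positivity)
      nlinarith
    have hηm : m * (K * η) ≤ ε / 4 := by
      have h1 : η * (4 * ((K + 1) * (m + 1))) = ε := div_mul_cancel₀ _ (by positivity)
      have h2 : 0 ≤ m := ENNReal.toReal_nonneg
      have h3 : K * m ≤ (K + 1) * (m + 1) := by nlinarith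
      nlinarith [mul_le_mul_of_nonneg_left h3 hη.le]
    calc _ ≤ ENNReal.ofReal δ * eLpNorm (v n - v k) p μ +
          μ Set.univ ^ p.toReal⁻¹ * ENNReal.ofReal (K * η) :=
          eLpNorm_le_of_ae_norm_le_mul_add hp ((hvm n).sub (hvm k)) hδ.le (by positivity) hbound
      _ ≤ ENNReal.ofReal δ * (C + C) + μ Set.univ ^ p.toReal⁻¹ * ENNReal.ofReal (K * η) := by
          gcongr
      _ = ENNReal.ofReal (δ * (C.toReal + C.toReal) + m * (K * η)) := by
          rw [ENNReal.ofReal_add (by positivity) (by positivity), ENNReal.ofReal_mul hδ.le,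
            ENNReal.ofReal_mul ENNReal.toReal_nonneg, ENNReal.ofReal_toReal hmtop,
            ENNReal.ofReal_add ENNReal.toReal_nonneg ENNReal.toReal_nonneg,
            ENNReal.ofReal_toReal hC]
      _ < ENNReal.ofReal ε := (ENNReal.ofReal_lt_ofReal_iff hε).2 (by linarith)
  obtain ⟨l, -, φ, hφ, hlim⟩ := (hU.closure.isCompact_of_isClosed isClosed_closure).tendsto_subseq
    (fun n => subset_closure (Set.mem_range_self n))
  refine ⟨φ, hφ, l, ?_⟩
  refine ((Lp.tendsto_Lp_iff_tendsto_eLpNorm' _ _).1 hlim).congr fun k => eLpNorm_congr_ae ?_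
  filter_upwards [(huL (φ k)).coeFn_toLp] with t ht
  simp [U, ht]
end

section
/- Let d ∈ ℕ and suppose A : [0,∞) × ℝᵈ → ℝᵈ and B : [0,∞) × [0,∞) × ℝᵈ → ℝᵈ are continuous and affine linear in the last variable, i.e., A(t,x) = A₁(t)x + a(t) and B(t,s,x) = B₁(t,s)x + b(t,s) with continuous matrix-valued functions A₁ : [0,∞) → ℝ^{d×d}, B₁ : [0,∞)² → ℝ^{d×d} and continuous vector-valued functions a : [0,∞) → ℝᵈ, b : [0,∞)² → ℝᵈ. Then for every α₀ ∈ ℝᵈ there exists a globally defined continuously differentiable function α : [0,∞) → ℝᵈ with α(0) = α₀ and α'(t) = A(t, α(t)) + ∫₀ᵗ B(t, s, α(s)) ds for all t ∈ [0,∞). -/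
open Filter Set Matrix

/-- The exponential weight `exp (2 ∫₀ᵗ k)` is increasing on `[0, ∞)` when `k ≥ 0` there, and turns
integration against `k` into a contraction by the factor `1 / 2`. -/
lemma exists_weight_integral_mul_le_half {k : ℝ → ℝ} (hk : Continuous k)
    (hk0 : ∀ t, 0 ≤ t → 0 ≤ k t) :
    ∃ W : ℝ → ℝ, Continuous W ∧ (∀ t, 0 < W t) ∧ W 0 = 1 ∧ MonotoneOn W (Ici 0) ∧
      ∀ t, ∫ s in (0:ℝ)..t, k s * W s ≤ W t / 2 := by
  have hderiv : ∀ t, HasDerivAt (fun t => ∫ s in (0:ℝ)..t, k s) (k t) t := fun t =>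
    intervalIntegral.integral_hasDerivAt_right (hk.intervalIntegrable _ _)
      (hk.stronglyMeasurableAtFilter _ _) hk.continuousAt
  have hW : ∀ t, HasDerivAt (fun t => Real.exp (2 * ∫ s in (0:ℝ)..t, k s))
      (Real.exp (2 * ∫ s in (0:ℝ)..t, k s) * (2 * k t)) t := fun t =>
    ((hderiv t).const_mul 2).exp
  have hWc : Continuous (fun t => Real.exp (2 * ∫ s in (0:ℝ)..t, k s)) :=
    continuous_iff_continuousAt.2 fun t => (hW t).continuousAt
  refine ⟨_, hWc, fun t => Real.exp_pos _, by simp, ?_, fun t => ?_⟩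
  · refine monotoneOn_of_hasDerivWithinAt_nonneg (convex_Ici 0) hWc.continuousOn
      (fun t _ => (hW t).hasDerivWithinAt) fun t ht => ?_
    rw [interior_Ici] at ht
    have := hk0 t (le_of_lt ht)
    positivity
  · have h := intervalIntegral.integral_eq_sub_of_hasDerivAt (a := 0) (b := t)
      (fun s _ => (hW s).div_const 2)
      ((by fun_prop : Continuous fun s =>
        Real.exp (2 * ∫ r in (0:ℝ)..s, k r) * (2 * k s) / 2).intervalIntegrable _ _)
    have hcongr : (fun s => k s * Real.exp (2 * ∫ r in (0:ℝ)..s, k r)) =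
        fun s => Real.exp (2 * ∫ r in (0:ℝ)..s, k r) * (2 * k s) / 2 := by
      funext s; ring
    rw [hcongr, h]
    simp

/-- Global existence for `α' = F α` on `[0, ∞)`, where `F` is a causal functional that is
Lipschitz with a locally bounded constant: `F u s` depends on `u` only through its values on
`[0, s]`, with Lipschitz constant `κ s` for the supremum norm. -/
theorem exists_hasDerivWithinAt_of_causal_lipschitz {E : Type*} [NormedAddCommGroup E]
    [NormedSpace ℝ E] [CompleteSpace E] {F : (ℝ → E) → ℝ → E} {κ : ℝ → ℝ}
    (hF : ∀ u, Continuous u → Continuous (F u)) (hκ : Continuous κ)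
    (hκ0 : ∀ t, 0 ≤ t → 0 ≤ κ t)
    (hLip : ∀ u v, Continuous u → Continuous v → ∀ s, 0 ≤ s → ∀ M,
      (∀ r ∈ Icc 0 s, ‖u r - v r‖ ≤ M) → ‖F u s - F v s‖ ≤ κ s * M)
    (α₀ : E) :
    ∃ α : ℝ → E, α 0 = α₀ ∧ ∀ t, 0 ≤ t → HasDerivWithinAt α (F α t) (Ici 0) t := by
  have hF0 : Continuous (F 0) := hF 0 continuous_const
  obtain ⟨W, hWc, hWpos, hW0, hWmono, hWint⟩ :=
    exists_weight_integral_mul_le_half (k := fun s => κ s + ‖F 0 s‖) (by fun_prop)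
      fun t ht => add_nonneg (hκ0 t ht) (norm_nonneg _)
  have hW1 : ∀ t, 0 ≤ t → 1 ≤ W t := fun t ht => hW0 ▸ hWmono self_mem_Ici ht ht
  have norm_integral_le : ∀ (g : ℝ → E) (C : ℝ), 0 ≤ C → ∀ t, 0 ≤ t →
      (∀ s, 0 ≤ s → ‖g s‖ ≤ C * ((κ s + ‖F 0 s‖) * W s)) →
      ‖∫ s in (0:ℝ)..t, g s‖ ≤ C * (W t / 2) := by
    intro g C hC t ht hg
    calc ‖∫ s in (0:ℝ)..t, g s‖
        ≤ ∫ s in (0:ℝ)..t, C * ((κ s + ‖F 0 s‖) * W s) :=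
          intervalIntegral.norm_integral_le_of_norm_le ht
            (Eventually.of_forall fun s hs => hg s hs.1.le)
            ((by fun_prop : Continuous fun s =>
              C * ((κ s + ‖F 0 s‖) * W s)).intervalIntegrable _ _)
      _ ≤ C * (W t / 2) := by
          rw [intervalIntegral.integral_const_mul]
          exact mul_le_mul_of_nonneg_left (hWint t) hC
  have integral_sub_le : ∀ u v, Continuous u → Continuous v → ∀ C, 0 ≤ C →
      (∀ r, 0 ≤ r → ‖u r - v r‖ ≤ C * W r) → ∀ t, 0 ≤ t →
      ‖(∫ s in (0:ℝ)..t, F u s) - ∫ s in (0:ℝ)..t, F v s‖ ≤ C * (W t / 2) := by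
    intro u v hu hv C hC huv t ht
    rw [← intervalIntegral.integral_sub ((hF u hu).intervalIntegrable _ _)
      ((hF v hv).intervalIntegrable _ _)]
    refine norm_integral_le _ C hC t ht fun s hs => ?_
    calc ‖F u s - F v s‖ ≤ κ s * (C * W s) :=
          hLip u v hu hv s hs _ fun r hr => (huv r hr.1).trans
            (mul_le_mul_of_nonneg_left (hWmono hr.1 hs hr.2) hC)
      _ ≤ C * ((κ s + ‖F 0 s‖) * W s) := by
          have : 0 ≤ C * (‖F 0 s‖ * W s) :=
            mul_nonneg hC (mul_nonneg (norm_nonneg _) (hWpos s).le)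
          linarith
  have integral_zero_le : ∀ t, 0 ≤ t → ‖∫ s in (0:ℝ)..t, F 0 s‖ ≤ 1 * (W t / 2) := by
    intro t ht
    refine norm_integral_le _ 1 zero_le_one t ht fun s hs => ?_
    have h1 : 0 ≤ κ s * W s := mul_nonneg (hκ0 s hs) (hWpos s).le
    have h2 : ‖F 0 s‖ * 1 ≤ ‖F 0 s‖ * W s :=
      mul_le_mul_of_nonneg_left (hW1 s hs) (norm_nonneg _)
    linarith
  let lift : BoundedContinuousFunction ℝ E → ℝ → E := fun v t => W t • v t
  have hlift : ∀ v, Continuous (lift v) := fun v => hWc.smul v.continuous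
  have hlift_sub : ∀ v w r, 0 ≤ r → ‖lift v r - lift w r‖ ≤ dist v w * W r := by
    intro v w r _
    rw [← smul_sub, norm_smul, Real.norm_of_nonneg (hWpos r).le, mul_comm, ← dist_eq_norm]
    exact mul_le_mul_of_nonneg_right (v.dist_coe_le_dist r) (hWpos r).le
  have hlift_zero : lift 0 = 0 := by funext t; simp [lift]
  let G : BoundedContinuousFunction ℝ E → ℝ → E := fun v t =>
    (W (max t 0))⁻¹ • (α₀ + ∫ s in (0:ℝ)..max t 0, F (lift v) s)
  have hGc : ∀ v, Continuous (G v) := by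
    intro v
    have hprim : Continuous fun t => ∫ s in (0:ℝ)..t, F (lift v) s :=
      intervalIntegral.continuous_primitive
        (fun a b => (hF _ (hlift v)).intervalIntegrable a b) 0
    have hmax : Continuous fun t : ℝ => max t 0 := continuous_id.max continuous_const
    exact ((hWc.comp hmax).inv₀ fun t => (hWpos _).ne').smul
      (continuous_const.add (hprim.comp hmax))
  have hGb : ∀ v t, ‖G v t‖ ≤ ‖α₀‖ + dist v 0 / 2 + 1 / 2 := by
    intro v t
    have ht : (0:ℝ) ≤ max t 0 := le_max_right _ _
    have hsub := integral_sub_le _ _ (hlift v) (hlift 0) _ dist_nonneg (hlift_sub v 0) _ ht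
    rw [hlift_zero] at hsub
    have hz := integral_zero_le _ ht
    have htri := norm_add_le ((∫ s in (0:ℝ)..max t 0, F (lift v) s) -
      ∫ s in (0:ℝ)..max t 0, F 0 s) (∫ s in (0:ℝ)..max t 0, F 0 s)
    rw [sub_add_cancel] at htri
    have hadd := norm_add_le α₀ (∫ s in (0:ℝ)..max t 0, F (lift v) s)
    have hα : ‖α₀‖ * 1 ≤ ‖α₀‖ * W (max t 0) :=
      mul_le_mul_of_nonneg_left (hW1 _ ht) (norm_nonneg _)
    rw [norm_smul, norm_inv, Real.norm_of_nonneg (hWpos _).le, inv_mul_le_iff₀ (hWpos _)]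
    linarith
  let Φ : BoundedContinuousFunction ℝ E → BoundedContinuousFunction ℝ E := fun v =>
    BoundedContinuousFunction.ofNormedAddCommGroup (G v) (hGc v) _ (hGb v)
  have hΦ : ContractingWith (1 / 2) Φ := by
    refine ⟨half_lt_self one_pos,
      LipschitzWith.of_dist_le_mul fun v w => ?_⟩
    refine (BoundedContinuousFunction.dist_le (by positivity)).2 fun t => ?_
    have ht : (0:ℝ) ≤ max t 0 := le_max_right _ _
    have hsub := integral_sub_le _ _ (hlift v) (hlift w) _ dist_nonneg (hlift_sub v w) _ ht
    change dist (G v t) (G w t) ≤ _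
    rw [dist_eq_norm, ← smul_sub, add_sub_add_left_eq_sub, norm_smul, norm_inv,
      Real.norm_of_nonneg (hWpos _).le, inv_mul_le_iff₀ (hWpos _)]
    push_cast
    linarith
  obtain ⟨v, hv⟩ : ∃ v, Φ v = v := ⟨_, hΦ.fixedPoint_isFixedPt⟩
  have hsol : ∀ t, 0 ≤ t → lift v t = α₀ + ∫ s in (0:ℝ)..t, F (lift v) s := by
    intro t ht
    have hvt : v t = (W t)⁻¹ • (α₀ + ∫ s in (0:ℝ)..t, F (lift v) s) := by
      conv_lhs => rw [← hv]
      change G v t = _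
      simp only [G, max_eq_left ht]
    change W t • v t = _
    rw [hvt, smul_inv_smul₀ (hWpos t).ne']
  refine ⟨lift v, by simpa using hsol 0 le_rfl, fun t ht => ?_⟩
  have hFv := hF _ (hlift v)
  have hderiv : HasDerivAt (fun t => α₀ + ∫ s in (0:ℝ)..t, F (lift v) s) (F (lift v) t) t :=
    (intervalIntegral.integral_hasDerivAt_right (hFv.intervalIntegrable _ _)
      (hFv.stronglyMeasurableAtFilter _ _) hFv.continuousAt).const_add α₀
  exact hderiv.hasDerivWithinAt.congr hsol (hsol t ht)

/-- Global existence for affine Volterra integro-differential equations in a Banach space, with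
coefficients continuous on the whole line. -/
theorem exists_hasDerivWithinAt_volterra_affine {E : Type*} [NormedAddCommGroup E]
    [NormedSpace ℝ E] [CompleteSpace E] {A : ℝ → E →L[ℝ] E} {a : ℝ → E}
    {B : ℝ → ℝ → E →L[ℝ] E} {b : ℝ → ℝ → E} (hA : Continuous A) (ha : Continuous a)
    (hB : Continuous fun q : ℝ × ℝ => B q.1 q.2) (hb : Continuous fun q : ℝ × ℝ => b q.1 q.2)
    (α₀ : E) :
    ∃ α : ℝ → E, α 0 = α₀ ∧ ∀ t, 0 ≤ t →
      HasDerivWithinAt α ((A t (α t) + a t) + ∫ s in (0:ℝ)..t, (B t s (α s) + b t s))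
        (Ici 0) t := by
  have hint : ∀ u : ℝ → E, Continuous u →
      Continuous fun q : ℝ × ℝ => B q.1 q.2 (u q.2) + b q.1 q.2 := fun u hu =>
    (hB.clm_apply (hu.comp continuous_snd)).add hb
  have hBt : ∀ t, Continuous fun s => ‖B t s‖ := fun t =>
    (hB.comp (by fun_prop : Continuous fun s : ℝ => (t, s))).norm
  refine exists_hasDerivWithinAt_of_causal_lipschitz
    (F := fun u t => (A t (u t) + a t) + ∫ s in (0:ℝ)..t, (B t s (u s) + b t s))
    (κ := fun t => ‖A t‖ + ∫ s in (0:ℝ)..t, ‖B t s‖) ?_ ?_ ?_ ?_ α₀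
  · intro u hu
    exact ((hA.clm_apply hu).add ha).add
      (intervalIntegral.continuous_parametric_intervalIntegral_of_continuous (hint u hu)
        continuous_id)
  · exact hA.norm.add
      (intervalIntegral.continuous_parametric_intervalIntegral_of_continuous
        (f := fun t s => ‖B t s‖) hB.norm continuous_id)
  · exact fun t ht => add_nonneg (norm_nonneg _)
      (intervalIntegral.integral_nonneg ht fun _ _ => norm_nonneg _)
  · intro u v hu hv s hs M hM
    have hsection : ∀ w : ℝ → E, Continuous w →
        IntervalIntegrable (fun r => B s r (w r) + b s r) MeasureTheory.volume 0 s := fun w hw =>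
      ((hint w hw).comp (by fun_prop : Continuous fun r : ℝ => (s, r))).intervalIntegrable _ _
    have hpoint : ‖A s (u s - v s)‖ ≤ ‖A s‖ * M :=
      (A s).le_opNorm_of_le (hM s (right_mem_Icc.2 hs))
    have hintegral : ‖∫ r in (0:ℝ)..s, B s r (u r - v r)‖ ≤ (∫ r in (0:ℝ)..s, ‖B s r‖) * M := by
      rw [← intervalIntegral.integral_mul_const]
      exact intervalIntegral.norm_integral_le_of_norm_le hs
        (Eventually.of_forall fun r hr => (B s r).le_opNorm_of_le (hM r (Ioc_subset_Icc_self hr)))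
        (((hBt s).mul continuous_const).intervalIntegrable _ _)
    have hdiff : (∫ r in (0:ℝ)..s, (B s r (u r) + b s r)) -
        ∫ r in (0:ℝ)..s, (B s r (v r) + b s r) = ∫ r in (0:ℝ)..s, B s r (u r - v r) := by
      rw [← intervalIntegral.integral_sub (hsection u hu) (hsection v hv)]
      simp only [add_sub_add_right_eq_sub, map_sub]
    rw [add_sub_add_comm, hdiff, add_sub_add_right_eq_sub, ← map_sub, add_mul]
    exact (norm_add_le _ _).trans (add_le_add hpoint hintegral)

/-- **Global existence for affine linear Volterra integro-differential equations.** If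
`A(t,x) = A₁(t)x + a(t)` and `B(t,s,x) = B₁(t,s)x + b(t,s)` with continuous matrix- and
vector-valued coefficients, then for every `α₀ ∈ ℝᵈ` there is a globally defined
continuously differentiable solution of `α' = A(t,α(t)) + ∫₀ᵗ B(t,s,α(s)) ds`, `α(0) = α₀`. -/
theorem volterra_linear_global_existence (d : ℕ)
    (A₁ : ℝ → Matrix (Fin d) (Fin d) ℝ) (a : ℝ → Fin d → ℝ)
    (B₁ : ℝ → ℝ → Matrix (Fin d) (Fin d) ℝ) (b : ℝ → ℝ → Fin d → ℝ)
    (hA₁ : ContinuousOn A₁ (Set.Ici 0)) (ha : ContinuousOn a (Set.Ici 0))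
    (hB₁ : ContinuousOn (fun q : ℝ × ℝ => B₁ q.1 q.2) (Set.Ici 0 ×ˢ Set.Ici 0))
    (hb : ContinuousOn (fun q : ℝ × ℝ => b q.1 q.2) (Set.Ici 0 ×ˢ Set.Ici 0))
    (α₀ : Fin d → ℝ) :
    ∃ α : ℝ → Fin d → ℝ, α 0 = α₀ ∧
      ∀ t : ℝ, 0 ≤ t →
        HasDerivWithinAt α
          ((A₁ t *ᵥ α t + a t) + ∫ s in (0:ℝ)..t, (B₁ t s *ᵥ α s + b t s))
          (Set.Ici 0) t := by
  let toCLM : Matrix (Fin d) (Fin d) ℝ →ₗ[ℝ] (Fin d → ℝ) →L[ℝ] (Fin d → ℝ) :=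
    LinearMap.toContinuousLinearMap.toLinearMap ∘ₗ Matrix.toLin'.toLinearMap
  have htoCLM : Continuous toCLM := toCLM.continuous_of_finiteDimensional
  have toCLM_apply : ∀ M x, toCLM M x = M *ᵥ x := fun M x => Matrix.toLin'_apply M x
  have hmax : Continuous fun t : ℝ => max t 0 := continuous_id.max continuous_const
  have hmax_mem : ∀ t : ℝ, max t 0 ∈ Ici (0:ℝ) := fun t => le_max_right t 0
  have hmax₂ : Continuous fun q : ℝ × ℝ => (max q.1 0, max q.2 0) :=
    (hmax.comp continuous_fst).prodMk (hmax.comp continuous_snd)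
  have hmax₂_mem : ∀ q : ℝ × ℝ, (max q.1 0, max q.2 0) ∈ Ici (0:ℝ) ×ˢ Ici (0:ℝ) := fun q =>
    ⟨hmax_mem q.1, hmax_mem q.2⟩
  obtain ⟨α, hα0, hα⟩ := exists_hasDerivWithinAt_volterra_affine
    (A := fun t => toCLM (A₁ (max t 0))) (a := fun t => a (max t 0))
    (B := fun t s => toCLM (B₁ (max t 0) (max s 0))) (b := fun t s => b (max t 0) (max s 0))
    (htoCLM.comp (hA₁.comp_continuous hmax hmax_mem)) (ha.comp_continuous hmax hmax_mem)
    (htoCLM.comp (hB₁.comp_continuous hmax₂ hmax₂_mem)) (hb.comp_continuous hmax₂ hmax₂_mem) α₀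
  refine ⟨α, hα0, fun t ht => ?_⟩
  have hintegral : ∫ s in (0:ℝ)..t, (B₁ t s *ᵥ α s + b t s) =
      ∫ s in (0:ℝ)..t, (toCLM (B₁ (max t 0) (max s 0)) (α s) + b (max t 0) (max s 0)) := by
    refine intervalIntegral.integral_congr fun s hs => ?_
    rw [uIcc_of_le ht] at hs
    simp only [toCLM_apply, max_eq_left ht, max_eq_left hs.1]
  have h := hα t ht
  rw [← hintegral, toCLM_apply, max_eq_left ht] at h
  exact h
end

section
/- Let X, Y, Z be normed vector spaces, let T : X → Y be a compact linear operator and let S : Y → Z be an injective continuous linear operator. Then for every ε > 0 there exists a constant C(ε) ≥ 0 such that for all x ∈ X one has ‖T x‖_Y ≤ ε ‖x‖_X + C(ε) ‖S(T x)‖_Z. (Ehrling's lemma.) -/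
/-- **Ehrling's lemma.** If `T : X → Y` is a compact linear operator and `S : Y → Z` is an
injective continuous linear operator between normed spaces, then for every `ε > 0` there is
a constant `C(ε) ≥ 0` such that `‖T x‖ ≤ ε ‖x‖ + C(ε) ‖S (T x)‖` for all `x`. -/
theorem ehrling_lemma
    {X Y Z : Type*} [NormedAddCommGroup X] [NormedSpace ℝ X]
    [NormedAddCommGroup Y] [NormedSpace ℝ Y]
    [NormedAddCommGroup Z] [NormedSpace ℝ Z]
    (T : X →L[ℝ] Y) (hT : IsCompactOperator (⇑T))
    (S : Y →L[ℝ] Z) (hS : Function.Injective (⇑S)) :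
    ∀ ε : ℝ, 0 < ε → ∃ Cε : ℝ, 0 ≤ Cε ∧
      ∀ x : X, ‖T x‖ ≤ ε * ‖x‖ + Cε * ‖S (T x)‖ := by
  intro ε hε
  obtain ⟨K, hK, hTK⟩ :=
    IsCompactOperator.image_closedBall_subset_compact (f := (T : X →ₗ[ℝ] Y)) hT 1
  have hS_ne : ∀ y ∈ K ∩ {y : Y | ε ≤ ‖y‖}, ‖S y‖ ≠ 0 := fun y hy h ↦ by
    have hy0 : y = 0 := hS (by rw [norm_eq_zero.mp h, map_zero])
    have hεy : ε ≤ ‖y‖ := hy.2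
    rw [hy0, norm_zero] at hεy
    exact hεy.not_gt hε
  have hcompact : IsCompact (K ∩ {y : Y | ε ≤ ‖y‖}) :=
    hK.inter_right (isClosed_le continuous_const continuous_norm)
  obtain ⟨C, hC⟩ := hcompact.exists_bound_of_continuousOn
    (f := fun y ↦ ‖y‖ / ‖S y‖)
    (continuous_norm.continuousOn.div S.continuous.norm.continuousOn hS_ne)
  refine ⟨max C 0, le_max_right _ _, fun x ↦ ?_⟩
  rcases eq_or_ne x 0 with rfl | hx
  · simp
  have hx' : 0 < ‖x‖ := norm_pos_iff.mpr hx
  have hunit : ‖T (‖x‖⁻¹ • x)‖ ≤ ε + max C 0 * ‖S (T (‖x‖⁻¹ • x))‖ := by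
    have hmem : T (‖x‖⁻¹ • x) ∈ K := hTK ⟨‖x‖⁻¹ • x, by simp [norm_smul, hx], rfl⟩
    rcases le_total ‖T (‖x‖⁻¹ • x)‖ ε with h | h
    · exact h.trans (le_add_of_nonneg_right (by positivity))
    · have hpos := (norm_nonneg _).lt_of_ne' (hS_ne _ ⟨hmem, h⟩)
      have hle := ((le_abs_self _).trans (hC _ ⟨hmem, h⟩)).trans (le_max_left C 0)
      rw [div_le_iff₀ hpos] at hle
      linarith
  simp only [map_smul, norm_smul, norm_inv, norm_norm] at hunit
  have hscaled := mul_le_mul_of_nonneg_left hunit hx'.le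
  field_simp at hscaled
  linarith
end

section
/- Let 1 ≤ p < ∞ and s > 0, let Ω' ⊆ ℝ³ be open, and let v : ℝ³ → ℝ be measurable with v = 0 almost everywhere outside a set K ⊆ ℝ³ satisfying δ := dist(K, ℝ³∖Ω') > 0. Then the Gagliardo seminorm satisfies |v|_{s,p;ℝ³}^p ≤ |v|_{s,p;Ω'}^p + 2 c(s,p) δ^{−sp} ∫_{ℝ³} |v(x)|^p dx, where c(s,p) = ∫_{|z|≥1} |z|^{−3−sp} dz < ∞. -/
open MeasureTheory Set
open scoped ENNReal

/-- The Gagliardo seminorm (to the `p`-th power)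
`|u|_{s,p;U}^p = ∫_U ∫_U |u(x) − u(y)|^p / |x−y|^{3+sp} dy dx` on a set `U ⊆ ℝ³`. -/
noncomputable def gagliardoSeminorm (U : Set (EuclideanSpace ℝ (Fin 3)))
    (u : EuclideanSpace ℝ (Fin 3) → ℝ) (s p : ℝ) : ℝ≥0∞ :=
  ∫⁻ x in U, ∫⁻ y in U, ENNReal.ofReal (|u x - u y| ^ p / ‖x - y‖ ^ (3 + s * p))

section FarKernel

variable {E : Type*} [NormedAddCommGroup E]

/-- The kernel `‖z‖ ^ (-r)` cut off to the region `δ ≤ ‖z‖`. -/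
noncomputable def farKernel (δ r : ℝ) (z : E) : ℝ≥0∞ :=
  {z : E | δ ≤ ‖z‖}.indicator (fun z => ENNReal.ofReal (‖z‖ ^ (-r))) z

theorem farKernel_of_le {δ : ℝ} (r : ℝ) {z : E} (hz : δ ≤ ‖z‖) :
    farKernel δ r z = ENNReal.ofReal (‖z‖ ^ (-r)) :=
  indicator_of_mem (s := {z : E | δ ≤ ‖z‖}) hz _

theorem farKernel_smul [NormedSpace ℝ E] {δ : ℝ} (hδ : 0 < δ) (r : ℝ) (z : E) :
    farKernel δ r (δ • z) = ENNReal.ofReal (δ ^ (-r)) * farKernel 1 r z := by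
  simp only [farKernel, indicator, mem_ofPred_eq, norm_smul, Real.norm_of_nonneg hδ.le,
    le_mul_iff_one_le_right hδ]
  split_ifs
  · rw [Real.mul_rpow hδ.le (norm_nonneg z), ENNReal.ofReal_mul (by positivity)]
  · simp

variable [MeasurableSpace E] [BorelSpace E]

theorem measurableSet_le_norm (δ : ℝ) : MeasurableSet {z : E | δ ≤ ‖z‖} :=
  measurableSet_le measurable_const measurable_norm

theorem measurable_farKernel (δ r : ℝ) : Measurable (farKernel δ r : E → ℝ≥0∞) :=
  Measurable.indicator (by fun_prop) (measurableSet_le_norm δ)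

theorem lintegral_farKernel (μ : Measure E) (δ r : ℝ) :
    ∫⁻ z, farKernel δ r z ∂μ = ∫⁻ z in {z : E | δ ≤ ‖z‖}, ENNReal.ofReal (‖z‖ ^ (-r)) ∂μ :=
  lintegral_indicator (measurableSet_le_norm δ) _

variable [NormedSpace ℝ E] [FiniteDimensional ℝ E] (μ : Measure E) [μ.IsAddHaarMeasure]

theorem lintegral_farKernel_one_lt_top {r : ℝ} (hr : (Module.finrank ℝ E : ℝ) < r) :
    ∫⁻ z, farKernel 1 r z ∂μ < ⊤ := by
  have hr0 : 0 < r := (Nat.cast_nonneg _).trans_lt hr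
  have hle : ∀ z : E, farKernel 1 r z ≤
      ENNReal.ofReal (2 ^ r) * ENNReal.ofReal ((1 + ‖z‖) ^ (-r)) := by
    intro z
    by_cases hz : 1 ≤ ‖z‖
    · rw [farKernel_of_le r hz, ← ENNReal.ofReal_mul (by positivity)]
      apply ENNReal.ofReal_le_ofReal
      have hz0 : 0 < ‖z‖ := one_pos.trans_le hz
      rw [Real.rpow_neg hz0.le, Real.rpow_neg (by positivity), ← div_eq_mul_inv,
        ← Real.div_rpow (by norm_num) (by positivity), ← Real.inv_rpow hz0.le]
      refine Real.rpow_le_rpow (by positivity) ?_ hr0.le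
      rw [inv_eq_one_div, div_le_div_iff₀ hz0 (by positivity)]
      linarith
    · simp [farKernel, hz]
  refine (lintegral_mono hle).trans_lt ?_
  rw [lintegral_const_mul _ (by fun_prop)]
  exact ENNReal.mul_lt_top ENNReal.ofReal_lt_top (finite_integral_one_add_norm hr)

theorem lintegral_farKernel_eq_mul {δ : ℝ} (hδ : 0 < δ) (r : ℝ) :
    ∫⁻ z, farKernel δ r z ∂μ =
      ENNReal.ofReal (δ ^ (Module.finrank ℝ E - r)) * ∫⁻ z, farKernel 1 r z ∂μ := by
  have hpow : 0 < δ ^ Module.finrank ℝ E := by positivity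
  have key : ENNReal.ofReal (δ ^ Module.finrank ℝ E)⁻¹ * ∫⁻ z, farKernel δ r z ∂μ =
      ENNReal.ofReal (δ ^ (-r)) * ∫⁻ z, farKernel 1 r z ∂μ := by
    rw [← lintegral_const_mul _ (measurable_farKernel 1 r)]
    simp_rw [← farKernel_smul hδ]
    rw [← lintegral_map (measurable_farKernel δ r) (measurable_const_smul δ),
      Measure.map_addHaar_smul μ hδ.ne', lintegral_smul_measure, smul_eq_mul,
      abs_of_pos (inv_pos.2 hpow)]
  calc ∫⁻ z, farKernel δ r z ∂μ
      = ENNReal.ofReal (δ ^ Module.finrank ℝ E) *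
          (ENNReal.ofReal (δ ^ Module.finrank ℝ E)⁻¹ * ∫⁻ z, farKernel δ r z ∂μ) := by
        rw [← mul_assoc, ← ENNReal.ofReal_mul hpow.le, mul_inv_cancel₀ hpow.ne',
          ENNReal.ofReal_one, one_mul]
    _ = _ := by
        rw [key, ← mul_assoc, ← ENNReal.ofReal_mul hpow.le, ← Real.rpow_natCast,
          ← Real.rpow_add hδ, sub_eq_add_neg]

end FarKernel

theorem lintegral_lintegral_mul_sub {G : Type*} [AddCommGroup G] [MeasurableSpace G]
    [MeasurableAdd G] [MeasurableNeg G] (μ : Measure G) [μ.IsAddLeftInvariant]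
    [μ.IsNegInvariant] {f k : G → ℝ≥0∞} (hf : Measurable f)
    (hk : ∀ x, Measurable fun y => k (x - y)) :
    ∫⁻ x, ∫⁻ y, f x * k (x - y) ∂μ ∂μ = (∫⁻ x, f x ∂μ) * ∫⁻ z, k z ∂μ := by
  simp_rw [lintegral_const_mul _ (hk _), lintegral_sub_left_eq_self k]
  rw [lintegral_mul_const _ hf]

theorem abs_sub_rpow_div_le_of_eq_zero {E : Type*} [NormedAddCommGroup E] {v : E → ℝ}
    {p r δ : ℝ} (hp : p ≠ 0) {x y : E} (hy : v y = 0) (hx : v x ≠ 0 → δ ≤ ‖x - y‖) :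
    ENNReal.ofReal (|v x - v y| ^ p / ‖x - y‖ ^ r) ≤
      ENNReal.ofReal (|v x| ^ p) * farKernel δ r (x - y) := by
  by_cases hx0 : v x = 0
  · simp [hx0, hy, Real.zero_rpow hp]
  · rw [farKernel_of_le r (hx hx0), ← ENNReal.ofReal_mul (by positivity), hy, sub_zero,
      Real.rpow_neg (norm_nonneg _), div_eq_mul_inv]

/-- If `v : ℝ³ → ℝ` vanishes a.e. outside a set `K` whose distance `δ` to the complement
of the open set `Ω'` is positive, then
`|v|_{s,p;ℝ³}^p ≤ |v|_{s,p;Ω'}^p + 2 c(s,p) δ^{−sp} ∫_{ℝ³} |v|^p dx`,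
where `c(s,p) = ∫_{|z|≥1} |z|^{−3−sp} dz < ∞`. -/
theorem gagliardo_global_of_support_far_from_boundary
    (p s : ℝ) (hp : 1 ≤ p) (hs : 0 < s)
    (Ω' : Set (EuclideanSpace ℝ (Fin 3))) (hΩ' : IsOpen Ω')
    (v : EuclideanSpace ℝ (Fin 3) → ℝ) (hv : Measurable v)
    (K : Set (EuclideanSpace ℝ (Fin 3)))
    (hvK : ∀ᵐ x : EuclideanSpace ℝ (Fin 3), x ∉ K → v x = 0)
    (δ : ℝ) (hδpos : 0 < δ) (hδ : ∀ x ∈ K, ∀ y ∈ Ω'ᶜ, δ ≤ dist x y)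
    (c : ℝ≥0∞)
    (hc : c = ∫⁻ z in {z : EuclideanSpace ℝ (Fin 3) | 1 ≤ ‖z‖},
      ENNReal.ofReal (‖z‖ ^ (-(3 + s * p)))) :
    c ≠ ⊤ ∧
      gagliardoSeminorm Set.univ v s p ≤
        gagliardoSeminorm Ω' v s p +
          2 * c * ENNReal.ofReal (δ ^ (-(s * p))) *
            ∫⁻ x, ENNReal.ofReal (|v x| ^ p) := by
  have hp0 : p ≠ 0 := by positivity
  have hsp : 0 < s * p := by positivity
  rw [← lintegral_farKernel] at hc
  refine ⟨?_, ?_⟩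
  · rw [hc]
    refine (lintegral_farKernel_one_lt_top _ ?_).ne
    simp [hsp]
  set F : EuclideanSpace ℝ (Fin 3) → EuclideanSpace ℝ (Fin 3) → ℝ≥0∞ :=
    fun x y => ENNReal.ofReal (|v x - v y| ^ p / ‖x - y‖ ^ (3 + s * p)) with hF
  set g : EuclideanSpace ℝ (Fin 3) → ℝ≥0∞ := fun x => ENNReal.ofReal (|v x| ^ p) with hg
  set k : EuclideanSpace ℝ (Fin 3) → ℝ≥0∞ := farKernel δ (3 + s * p) with hk
  have hgm : Measurable g := by fun_prop
  have hkm : Measurable k := measurable_farKernel _ _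
  have hkint : ∫⁻ z, k z = c * ENNReal.ofReal (δ ^ (-(s * p))) := by
    rw [hk, lintegral_farKernel_eq_mul _ hδpos, hc, mul_comm]
    congr 3
    simp
  have hKfar : ∀ x y, (x ∉ K → v x = 0) → y ∉ Ω' → v x ≠ 0 → δ ≤ ‖x - y‖ := by
    intro x y hx hy hvx
    rw [← dist_eq_norm]
    exact hδ x (by_contra fun h => hvx (hx h)) y hy
  have hzero : ∀ x, (x ∉ K → v x = 0) → x ∉ Ω' → v x = 0 := by
    intro x hx hxΩ
    by_contra hvx
    have := hKfar x x hx hxΩ hvx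
    simp only [sub_self, norm_zero] at this
    linarith
  have hpt : ∀ x y, (x ∉ K → v x = 0) → (y ∉ K → v y = 0) →
      F x y ≤ Ω'.indicator (fun x => Ω'.indicator (F x) y) x +
        (g x * k (x - y) + g y * k (y - x)) := by
    intro x y hx hy
    by_cases hyΩ : y ∈ Ω'
    · by_cases hxΩ : x ∈ Ω'
      · simp [hxΩ, hyΩ]
      · refine le_trans (le_of_eq_of_le ?_ (abs_sub_rpow_div_le_of_eq_zero
          (r := 3 + s * p) hp0 (hzero x hx hxΩ) (hKfar y x hy hxΩ))) (le_add_left le_add_self)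
        simp only [hF]
        rw [abs_sub_comm, norm_sub_rev]
    · exact (abs_sub_rpow_div_le_of_eq_zero hp0 (hzero y hy hyΩ) (hKfar x y hx hyΩ)).trans
        (le_add_left le_self_add)
  have hΩm : MeasurableSet Ω' := hΩ'.measurableSet
  have hloc : ∫⁻ x, ∫⁻ y, Ω'.indicator (fun x => Ω'.indicator (F x) y) x =
      gagliardoSeminorm Ω' v s p := by
    rw [gagliardoSeminorm, ← lintegral_indicator hΩm]
    refine lintegral_congr fun x => ?_
    by_cases hxΩ : x ∈ Ω'
    · simp [hxΩ, lintegral_indicator hΩm, hF]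
    · simp [hxΩ]
  have hfar : ∫⁻ x, ∫⁻ y, g x * k (x - y) = (∫⁻ x, g x) * ∫⁻ z, k z :=
    lintegral_lintegral_mul_sub _ hgm fun x => by fun_prop
  have hfar_swap : ∫⁻ x, ∫⁻ y, g y * k (y - x) = (∫⁻ x, g x) * ∫⁻ z, k z := by
    rw [← hfar]
    refine lintegral_lintegral_swap (Measurable.aemeasurable ?_)
    simp only [Function.uncurry_def]
    fun_prop
  have hfarm : Measurable fun x => ∫⁻ y, g x * k (x - y) :=
    Measurable.lintegral_prod_right (f := fun x y => g x * k (x - y))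
      (by simp only [Function.uncurry_def]; fun_prop)
  have hfar_swapm : Measurable fun x => ∫⁻ y, g y * k (y - x) :=
    Measurable.lintegral_prod_right (f := fun x y => g y * k (y - x))
      (by simp only [Function.uncurry_def]; fun_prop)
  calc gagliardoSeminorm Set.univ v s p
      = ∫⁻ x, ∫⁻ y, F x y := by simp [gagliardoSeminorm, hF]
    _ ≤ ∫⁻ x, ∫⁻ y, (Ω'.indicator (fun x => Ω'.indicator (F x) y) x +
          (g x * k (x - y) + g y * k (y - x))) := by
        refine lintegral_mono_ae (hvK.mono fun x hx => ?_)
        exact lintegral_mono_ae (hvK.mono fun y hy => hpt x y hx hy)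
    _ = ∫⁻ x, ((∫⁻ y, Ω'.indicator (fun x => Ω'.indicator (F x) y) x) +
          ((∫⁻ y, g x * k (x - y)) + ∫⁻ y, g y * k (y - x))) := by
        refine lintegral_congr fun x => ?_
        rw [lintegral_add_right _ (by fun_prop), lintegral_add_left (by fun_prop)]
    _ = gagliardoSeminorm Ω' v s p +
          ((∫⁻ x, g x) * (∫⁻ z, k z) + (∫⁻ x, g x) * ∫⁻ z, k z) := by
        rw [lintegral_add_right, lintegral_add_left, hloc, hfar, hfar_swap]
        · exact hfarm
        · exact hfarm.add hfar_swapm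
    _ = _ := by
        rw [hkint]
        ring
end
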